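/- For all real numbers r > 0, s > 0 with r + s - rs > 0, every nonnegative integer n, and every real number x, the Gaussian convolution integral satisfies (1/√(πs)) ∫_{-∞}^{∞} exp(-(x-ξ)²/s) · exp(-ξ²/r) · H_n(ξ) dξ = √(r/(r+s)) · exp(-x²/(r+s)) · (√((r+s-rs)(r+s)) / (r+s))^n · H_n( r x / √((r+s-rs)(r+s)) ), where the positive square root is taken. -/

import Mathlib

open Finset MeasureTheory

/-- The physicists' Hermite polynomials. -/
noncomputable def Hphys (n : ℕ) (x : ℝ) : ℝ :=
  ∑ l ∈ Finset.range (n / 2 + 1),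
    (-1 : ℝ) ^ l * (Nat.factorial n : ℝ) /
      ((Nat.factorial l : ℝ) * (Nat.factorial (n - 2 * l) : ℝ)) * (2 * x) ^ (n - 2 * l)

namespace Hphys

/-- The `l`-th summand of `Hphys n x`, extended by zero to all `l`. -/
noncomputable def term (n l : ℕ) (x : ℝ) : ℝ :=
  if 2 * l ≤ n then
    (-1 : ℝ) ^ l * (n.factorial : ℝ) / ((l.factorial : ℝ) * ((n - 2 * l).factorial : ℝ)) *
      (2 * x) ^ (n - 2 * l)
  else 0

lemma eq_sum_term {n N : ℕ} (h : n / 2 + 1 ≤ N) (x : ℝ) :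
    Hphys n x = ∑ l ∈ Finset.range N, term n l x := by
  rw [← Finset.sum_subset (Finset.range_subset_range.2 h)]
  · refine Finset.sum_congr rfl fun l hl ↦ ?_
    rw [term, if_pos (by have := Finset.mem_range.1 hl; omega)]
  · intro l _ hl
    rw [term, if_neg (by have := mt Finset.mem_range.2 hl; omega)]

lemma term_zero_right (n : ℕ) (x : ℝ) : term n 0 x = (2 * x) ^ n := by
  simp [term, Nat.factorial_ne_zero]

lemma term_add_two (n l : ℕ) (x : ℝ) :
    term (n + 2) (l + 1) x = 2 * x * term (n + 1) (l + 1) x - 2 * (n + 1) * term n l x := by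
  rcases lt_trichotomy n (2 * l) with h | rfl | h
  · simp [term, show ¬ 2 * (l + 1) ≤ n + 2 by omega, show ¬ 2 * (l + 1) ≤ n + 1 by omega,
      show ¬ 2 * l ≤ n by omega]
  · have hl : (l.factorial : ℝ) ≠ 0 := by positivity
    have hl' : (l : ℝ) + 1 ≠ 0 := by positivity
    simp only [term, show 2 * (l + 1) ≤ 2 * l + 2 by omega,
      show ¬ 2 * (l + 1) ≤ 2 * l + 1 by omega, le_refl, if_true, if_false,
      show 2 * l + 2 - 2 * (l + 1) = 0 by omega, Nat.sub_self, Nat.factorial_succ,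
      Nat.factorial_zero]
    push_cast
    field_simp
    ring
  · obtain ⟨k, rfl⟩ : ∃ k, n = 2 * l + k + 1 := ⟨n - 2 * l - 1, by omega⟩
    have hl : (l.factorial : ℝ) ≠ 0 := by positivity
    have hk : (k.factorial : ℝ) ≠ 0 := by positivity
    have hl' : (l : ℝ) + 1 ≠ 0 := by positivity
    have hk' : (k : ℝ) + 1 ≠ 0 := by positivity
    simp only [term, show 2 * (l + 1) ≤ 2 * l + k + 1 + 2 by omega,
      show 2 * (l + 1) ≤ 2 * l + k + 1 + 1 by omega, show 2 * l ≤ 2 * l + k + 1 by omega, if_true,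
      show 2 * l + k + 1 + 2 - 2 * (l + 1) = k + 1 by omega,
      show 2 * l + k + 1 + 1 - 2 * (l + 1) = k by omega,
      show 2 * l + k + 1 - 2 * l = k + 1 by omega, Nat.factorial_succ]
    push_cast
    field_simp
    ring

@[simp] lemma zero (x : ℝ) : Hphys 0 x = 1 := by simp [Hphys]

@[simp] lemma one (x : ℝ) : Hphys 1 x = 2 * x := by simp [Hphys]

lemma add_two (n : ℕ) (x : ℝ) :
    Hphys (n + 2) x = 2 * x * Hphys (n + 1) x - 2 * (n + 1) * Hphys n x := by
  rw [eq_sum_term (N := n + 3) (by omega), eq_sum_term (n := n + 1) (N := n + 3) (by omega),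
    eq_sum_term (n := n) (N := n + 2) (by omega), Finset.sum_range_succ',
    Finset.sum_range_succ' (fun l ↦ term (n + 1) l x)]
  simp only [term_add_two, term_zero_right, Finset.sum_sub_distrib, ← Finset.mul_sum]
  ring

lemma hasDerivAt_succ (n : ℕ) (x : ℝ) :
    HasDerivAt (Hphys (n + 1)) (2 * (n + 1) * Hphys n x) x := by
  induction n using Nat.twoStepInduction with
  | zero =>
    have h : Hphys (0 + 1) = fun y ↦ 2 * y := funext one
    rw [h]
    simpa using (hasDerivAt_id x).const_mul 2
  | one =>
    have h : Hphys (1 + 1) = fun y ↦ 2 * y * (2 * y) - 2 := by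
      funext y
      simpa using add_two 0 y
    have h2 := (hasDerivAt_id x).const_mul 2
    rw [h]
    refine ((h2.mul h2).sub_const 2).congr_deriv ?_
    simp
    ring
  | more n ih₀ ih₁ =>
    have h : Hphys (n + 2 + 1) =
        fun y ↦ 2 * y * Hphys (n + 2) y - 2 * ((n + 1 : ℕ) + 1) * Hphys (n + 1) y :=
      funext fun y ↦ add_two (n + 1) y
    rw [h]
    refine ((((hasDerivAt_id x).const_mul 2).mul ih₁).sub (ih₀.const_mul _)).congr_deriv ?_
    have := add_two n x
    simp only [id]
    push_cast
    rw [show n + 1 + 1 = n + 2 from rfl, this]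
    ring

lemma exists_polynomial (n : ℕ) : ∃ p : Polynomial ℝ, ∀ x, Hphys n x = p.eval x := by
  induction n using Nat.twoStepInduction with
  | zero => exact ⟨1, by simp⟩
  | one => exact ⟨2 * Polynomial.X, by simp⟩
  | more n ih₀ ih₁ =>
    obtain ⟨p, hp⟩ := ih₀
    obtain ⟨q, hq⟩ := ih₁
    exact ⟨2 * Polynomial.X * q - Polynomial.C (2 * ((n : ℝ) + 1)) * p, fun x ↦ by
      simp [add_two, hp, hq]⟩

end Hphys

lemma Polynomial.integrable_eval_mul_exp_neg_mul_sq (p : Polynomial ℝ) {b : ℝ} (hb : 0 < b) :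
    Integrable fun ξ : ℝ ↦ p.eval ξ * Real.exp (-b * ξ ^ 2) := by
  induction p using Polynomial.induction_on' with
  | add p q hp hq =>
    simp only [eval_add, add_mul]
    exact hp.add hq
  | monomial n a =>
    have h := integrable_rpow_mul_exp_neg_mul_sq hb (s := n)
      (by have := n.cast_nonneg (α := ℝ); linarith)
    simpa [mul_assoc] using h.const_mul a

lemma Polynomial.integrable_exp_neg_mul_sub_sq_mul_eval (p : Polynomial ℝ) {b : ℝ} (hb : 0 < b)
    (μ : ℝ) : Integrable fun ξ : ℝ ↦ Real.exp (-b * (ξ - μ) ^ 2) * p.eval ξ := by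
  have h := ((p.comp (X + C μ)).integrable_eval_mul_exp_neg_mul_sq hb).comp_sub_right μ
  simpa [mul_comm] using h

lemma Hphys.integrable_exp_neg_mul_sub_sq_mul (n : ℕ) {b : ℝ} (hb : 0 < b) (μ : ℝ) :
    Integrable fun ξ : ℝ ↦ Real.exp (-b * (ξ - μ) ^ 2) * Hphys n ξ := by
  obtain ⟨p, hp⟩ := exists_polynomial n
  simpa only [hp] using p.integrable_exp_neg_mul_sub_sq_mul_eval hb μ

lemma Hphys.integrable_exp_neg_mul_sub_sq_mul_id_mul (n : ℕ) {b : ℝ} (hb : 0 < b) (μ : ℝ) :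
    Integrable fun ξ : ℝ ↦ Real.exp (-b * (ξ - μ) ^ 2) * (ξ * Hphys n ξ) := by
  obtain ⟨p, hp⟩ := exists_polynomial n
  have h := (Polynomial.X * p).integrable_exp_neg_mul_sub_sq_mul_eval hb μ
  simpa only [hp, Polynomial.eval_mul, Polynomial.eval_X] using h

/-- Integration by parts against a Gaussian centred at `μ`. -/
lemma Hphys.integral_exp_neg_mul_sub_sq_mul_id_mul (n : ℕ) {b : ℝ} (hb : 0 < b) (μ : ℝ) :
    ∫ ξ : ℝ, Real.exp (-b * (ξ - μ) ^ 2) * (ξ * Hphys (n + 1) ξ) =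
      μ * (∫ ξ : ℝ, Real.exp (-b * (ξ - μ) ^ 2) * Hphys (n + 1) ξ) +
        (n + 1) / b * ∫ ξ : ℝ, Real.exp (-b * (ξ - μ) ^ 2) * Hphys n ξ := by
  have h₀ := integrable_exp_neg_mul_sub_sq_mul n hb μ
  have h₁ := integrable_exp_neg_mul_sub_sq_mul (n + 1) hb μ
  have hX := integrable_exp_neg_mul_sub_sq_mul_id_mul (n + 1) hb μ
  have hlin := ((h₁.const_mul (2 * b * μ)).sub (hX.const_mul (2 * b))).add
    (h₀.const_mul (2 * (n + 1)))
  have hderiv (ξ : ℝ) := by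
    have hexp : HasDerivAt (fun ξ ↦ Real.exp (-b * (ξ - μ) ^ 2)) _ ξ :=
      ((((hasDerivAt_id ξ).sub_const μ).pow 2).const_mul (-b)).exp
    exact hexp.mul (hasDerivAt_succ n ξ)
  have hzero := integral_eq_zero_of_hasDerivAt_of_integrable
    (fun ξ ↦ (hderiv ξ).congr_deriv (by simp; ring)) hlin h₁
  rw [integral_add' ((h₁.const_mul _).sub (hX.const_mul _)) (h₀.const_mul _),
    integral_sub' (h₁.const_mul _) (hX.const_mul _)] at hzero
  simp only [integral_const_mul] at hzero
  rw [← sub_eq_iff_eq_add', div_mul_eq_mul_div, eq_div_iff hb.ne']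
  linear_combination (-1 / 2) * hzero

lemma Hphys.integral_exp_neg_mul_sub_sq_mul (n : ℕ) {b c : ℝ} (hb : 0 < b) (hc : c ≠ 0)
    (hbc : c ^ 2 = 1 - 1 / b) (μ : ℝ) :
    ∫ ξ : ℝ, Real.exp (-b * (ξ - μ) ^ 2) * Hphys n ξ =
      Real.sqrt (Real.pi / b) * (c ^ n * Hphys n (μ / c)) := by
  have hgauss : ∫ ξ : ℝ, Real.exp (-b * (ξ - μ) ^ 2) = Real.sqrt (Real.pi / b) := by
    rw [integral_sub_right_eq_self (fun ξ ↦ Real.exp (-b * ξ ^ 2)) μ, integral_gaussian]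
  induction n using Nat.twoStepInduction with
  | zero => simpa using hgauss
  | one =>
    have hint : Integrable fun ξ : ℝ ↦ Real.exp (-b * (ξ - μ) ^ 2) := by
      simpa using integrable_exp_neg_mul_sub_sq_mul 0 hb μ
    have hid : Integrable fun ξ : ℝ ↦ Real.exp (-b * (ξ - μ) ^ 2) * ξ := by
      simpa using integrable_exp_neg_mul_sub_sq_mul_id_mul 0 hb μ
    have hodd : ∫ ξ : ℝ, Real.exp (-b * (ξ - μ) ^ 2) * (ξ - μ) = 0 := by
      rw [integral_sub_right_eq_self (fun ξ ↦ Real.exp (-b * ξ ^ 2) * ξ) μ]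
      have h := integral_neg_eq_self (fun ξ : ℝ ↦ Real.exp (-b * ξ ^ 2) * ξ) volume
      simp only [even_two, Even.neg_pow, mul_neg, integral_neg] at h
      linarith
    simp only [mul_sub] at hodd
    rw [integral_sub hid (hint.mul_const μ), integral_mul_const, hgauss] at hodd
    simp only [one, mul_left_comm _ (2 : ℝ), integral_const_mul]
    rw [show c ^ 1 * (μ / c) = μ by field_simp]
    linear_combination 2 * hodd
  | more n ih₀ ih₁ =>
    have h₀ := integrable_exp_neg_mul_sub_sq_mul n hb μ
    have hX := integrable_exp_neg_mul_sub_sq_mul_id_mul (n + 1) hb μ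
    have hsplit (ξ : ℝ) : Real.exp (-b * (ξ - μ) ^ 2) * Hphys (n + 2) ξ =
        2 * (Real.exp (-b * (ξ - μ) ^ 2) * (ξ * Hphys (n + 1) ξ)) -
          2 * (n + 1) * (Real.exp (-b * (ξ - μ) ^ 2) * Hphys n ξ) := by
      rw [add_two]
      ring
    simp only [hsplit]
    rw [integral_sub (hX.const_mul _) (h₀.const_mul _)]
    simp only [integral_const_mul]
    rw [integral_exp_neg_mul_sub_sq_mul_id_mul n hb, ih₀, ih₁, add_two]
    have hμ : μ = c * (μ / c) := by field_simp
    have hb' : 1 / b = 1 - c ^ 2 := by linarith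
    rw [div_eq_mul_one_div ((n : ℝ) + 1) b, hb']
    generalize μ / c = t at *
    subst hμ
    ring

theorem gaussian_convolution_hermite (r s : ℝ) (hr : 0 < r) (hs : 0 < s)
    (hrs : 0 < r + s - r * s) (n : ℕ) (x : ℝ) :
    (1 / Real.sqrt (Real.pi * s)) *
      ∫ ξ : ℝ, Real.exp (-(x - ξ) ^ 2 / s) * Real.exp (-ξ ^ 2 / r) * Hphys n ξ =
    Real.sqrt (r / (r + s)) * Real.exp (-x ^ 2 / (r + s)) *
      (Real.sqrt ((r + s - r * s) * (r + s)) / (r + s)) ^ n *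
      Hphys n (r * x / Real.sqrt ((r + s - r * s) * (r + s))) := by
  have hrs' : 0 < r + s := by positivity
  set S := Real.sqrt ((r + s - r * s) * (r + s)) with hS
  have hSpos : 0 < S := Real.sqrt_pos.2 (by positivity)
  have hSsq : S ^ 2 = (r + s - r * s) * (r + s) := Real.sq_sqrt (by positivity)
  have hb : 0 < (r + s) / (r * s) := by positivity
  have hc : S / (r + s) ≠ 0 := by positivity
  have hbc : (S / (r + s)) ^ 2 = 1 - 1 / ((r + s) / (r * s)) := by
    rw [div_pow, hSsq]
    field_simp
  have hsquare (ξ : ℝ) :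
      Real.exp (-(x - ξ) ^ 2 / s) * Real.exp (-ξ ^ 2 / r) * Hphys n ξ =
        Real.exp (-x ^ 2 / (r + s)) *
          (Real.exp (-((r + s) / (r * s)) * (ξ - r * x / (r + s)) ^ 2) * Hphys n ξ) := by
    rw [← mul_assoc, ← Real.exp_add, ← Real.exp_add]
    congr 2
    field_simp
    ring
  have hsqrt : 1 / Real.sqrt (Real.pi * s) * Real.sqrt (Real.pi / ((r + s) / (r * s))) =
      Real.sqrt (r / (r + s)) := by
    rw [one_div, ← Real.sqrt_inv, ← Real.sqrt_mul (by positivity)]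
    congr 1
    field_simp
  have harg : r * x / (r + s) / (S / (r + s)) = r * x / S := by field_simp
  simp only [hsquare]
  rw [integral_const_mul, Hphys.integral_exp_neg_mul_sub_sq_mul n hb hc hbc, harg, ← hsqrt]
  ring
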